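/- With the augmented reduction construction below (where k ≥ 2), any injection σ : X' → Y' with σ(x_{k+1}) ≠ p_{k+1} satisfies dist(σ) ≥ 5ρ/4. -/

import Mathlib

/-- Circular distance between the `j`-th and `j'`-th of `m` points spaced regularly
on a circle of perimeter 1: `(1/m) · min(j'−j, m+j−j')` for `j ≤ j'`. -/
noncomputable def ringDist (m : ℕ) (j j' : Fin m) : ℝ :=
  ((min (max j.val j'.val - min j.val j'.val)
        (m - (max j.val j'.val - min j.val j'.val)) : ℕ) : ℝ) / (m : ℝ)

/-- The distance on `Y = R_1 ∪ … ∪ R_k`, where `R_i = {p_{i1},…,p_{im}}` and the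
point `p_{ij}` (with `1 ≤ i ≤ k`, `1 ≤ j ≤ m`) is encoded as
`(⟨i-1⟩, ⟨j-1⟩) : Fin k × Fin m`.  Within a ring the distance is the circular
distance `ringDist`; for `i ≠ i'`, `d_Y(p_{ij}, p_{i'j'}) = 2^{max(i,i')}` if
`(v_j, v_{j'}) ∈ E` and `2^{max(i,i')} − 1/m` otherwise. -/
noncomputable def dY (m k : ℕ) (G : SimpleGraph (Fin m)) [DecidableRel G.Adj]
    (p q : Fin k × Fin m) : ℝ :=
  if p.1 = q.1 then ringDist m p.2 q.2
  else if G.Adj p.2 q.2 then (2 : ℝ) ^ (max p.1.val q.1.val + 1)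
  else (2 : ℝ) ^ (max p.1.val q.1.val + 1) - 1 / (m : ℝ)

/-- The augmented pattern `X' = {x_1,…,x_k, x_{k+1}}`, encoded as `Fin (k+1)`
with `x_{k+1} = Fin.last k`: `d_X(x_i, x_{i'}) = 2^{max(i,i')}·ρ` for distinct
`i, i' ≤ k`, and `d_X(x_i, x_{k+1}) = λ = 5mρ²·2^k`. -/
noncomputable def dX' (k m : ℕ) (ρ : ℝ) (i i' : Fin (k + 1)) : ℝ :=
  if i = i' then 0
  else if i = Fin.last k ∨ i' = Fin.last k then 5 * (m : ℝ) * ρ ^ 2 * 2 ^ k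
  else (2 : ℝ) ^ (max i.val i'.val + 1) * ρ

/-- The augmented space `Y' = Y ∪ {p_{k+1}}`, encoded as
`Option (Fin k × Fin m)` with `p_{k+1} = none`: the extra point `p_{k+1}` is at
distance `λ = 5mρ²·2^k` from every point of `Y`. -/
noncomputable def dY' (m k : ℕ) (G : SimpleGraph (Fin m)) [DecidableRel G.Adj]
    (ρ : ℝ) (p q : Option (Fin k × Fin m)) : ℝ :=
  match p, q with
  | none, none => 0
  | none, some _ => 5 * (m : ℝ) * ρ ^ 2 * 2 ^ k
  | some _, none => 5 * (m : ℝ) * ρ ^ 2 * 2 ^ k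
  | some a, some b => dY m k G a b

/-- The expansion of a map `σ` between spaces with distance functions `dA, dB`:
the maximum over distinct `x, x'` of `dB (σ x) (σ x') / dA x x'`. -/
noncomputable def expansionD {X Y : Type*} (dA : X → X → ℝ) (dB : Y → Y → ℝ)
    (σ : X → Y) : ℝ :=
  sSup {t : ℝ | ∃ x x' : X, x ≠ x' ∧ t = dB (σ x) (σ x') / dA x x'}

/-- The expansion of the inverse of an injection `σ`:
the maximum over distinct `x, x'` of `dA x x' / dB (σ x) (σ x')`. -/
noncomputable def expansionInvD {X Y : Type*} (dA : X → X → ℝ) (dB : Y → Y → ℝ)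
    (σ : X → Y) : ℝ :=
  sSup {t : ℝ | ∃ x x' : X, x ≠ x' ∧ t = dA x x' / dB (σ x) (σ x')}

theorem div_le_expansionD {X Y : Type*} [Finite X] (dA : X → X → ℝ) (dB : Y → Y → ℝ)
    (σ : X → Y) {x x' : X} (h : x ≠ x') :
    dB (σ x) (σ x') / dA x x' ≤ expansionD dA dB σ := by
  refine le_csSup (Set.Finite.bddAbove ?_) ⟨x, x', h, rfl⟩
  refine (Set.finite_range fun p : X × X => dB (σ p.1) (σ p.2) / dA p.1 p.2).subset ?_
  rintro t ⟨y, y', -, rfl⟩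
  exact ⟨(y, y'), rfl⟩

theorem div_le_expansionInvD {X Y : Type*} [Finite X] (dA : X → X → ℝ) (dB : Y → Y → ℝ)
    (σ : X → Y) {x x' : X} (h : x ≠ x') :
    dA x x' / dB (σ x) (σ x') ≤ expansionInvD dA dB σ := by
  refine le_csSup (Set.Finite.bddAbove ?_) ⟨x, x', h, rfl⟩
  refine (Set.finite_range fun p : X × X => dA p.1 p.2 / dB (σ p.1) (σ p.2)).subset ?_
  rintro t ⟨y, y', -, rfl⟩
  exact ⟨(y, y'), rfl⟩

theorem one_div_le_ringDist (m : ℕ) {j j' : Fin m} (h : j ≠ j') :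
    1 / (m : ℝ) ≤ ringDist m j j' := by
  unfold ringDist
  have hval : j.val ≠ j'.val := fun e => h (Fin.ext e)
  have hone : 1 ≤ min (max j.val j'.val - min j.val j'.val)
      (m - (max j.val j'.val - min j.val j'.val)) := by
    have := j.isLt
    have := j'.isLt
    omega
  gcongr
  exact_mod_cast hone

theorem ringDist_le_one (m : ℕ) (j j' : Fin m) : ringDist m j j' ≤ 1 := by
  unfold ringDist
  refine div_le_one_of_le₀ ?_ (Nat.cast_nonneg m)
  exact_mod_cast (min_le_right _ _).trans (Nat.sub_le _ _)

theorem one_div_le_dY {m k : ℕ} (hm : 1 ≤ m) (G : SimpleGraph (Fin m)) [DecidableRel G.Adj]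
    {p q : Fin k × Fin m} (h : p ≠ q) : 1 / (m : ℝ) ≤ dY m k G p q := by
  have hm' : 1 / (m : ℝ) ≤ 1 :=
    div_le_one_of_le₀ (by exact_mod_cast hm) (Nat.cast_nonneg m)
  have hpow : (2 : ℝ) ≤ 2 ^ (max p.1.val q.1.val + 1) :=
    le_self_pow₀ one_le_two (Nat.succ_ne_zero _)
  unfold dY
  split_ifs with hring hadj
  · exact one_div_le_ringDist m fun e => h (Prod.ext hring e)
  · linarith
  · linarith

theorem dY_le_two_pow (m k : ℕ) (G : SimpleGraph (Fin m)) [DecidableRel G.Adj]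
    (p q : Fin k × Fin m) : dY m k G p q ≤ 2 ^ k := by
  have hpow : (2 : ℝ) ^ (max p.1.val q.1.val + 1) ≤ 2 ^ k :=
    pow_le_pow_right₀ one_le_two (by have := p.1.isLt; have := q.1.isLt; omega)
  have hm : 0 ≤ 1 / (m : ℝ) := by positivity
  unfold dY
  split_ifs
  · exact (ringDist_le_one m _ _).trans (one_le_pow₀ one_le_two)
  · exact hpow
  · linarith

theorem one_div_le_dY' {m k : ℕ} (hm : 1 ≤ m) (G : SimpleGraph (Fin m)) [DecidableRel G.Adj]
    {ρ : ℝ} (hρ : 1 ≤ ρ) {p q : Option (Fin k × Fin m)} (h : p ≠ q) :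
    1 / (m : ℝ) ≤ dY' m k G ρ p q := by
  have hm1 : (1 : ℝ) ≤ m := by exact_mod_cast hm
  have hscale : 1 / (m : ℝ) ≤ 5 * (m : ℝ) * ρ ^ 2 * 2 ^ k := by
    have hinv : 1 / (m : ℝ) ≤ 1 := div_le_one_of_le₀ hm1 (Nat.cast_nonneg m)
    have hρ2 : 1 ≤ ρ ^ 2 := one_le_pow₀ hρ
    have h2k : (1 : ℝ) ≤ 2 ^ k := one_le_pow₀ one_le_two
    have h5m : 1 ≤ 5 * (m : ℝ) := by linarith
    exact hinv.trans (one_le_mul_of_one_le_of_one_le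
      (one_le_mul_of_one_le_of_one_le h5m hρ2) h2k)
  match p, q with
  | none, none => exact absurd rfl h
  | none, some _ => exact hscale
  | some _, none => exact hscale
  | some a, some b => exact one_div_le_dY hm G fun e => h (congrArg some e)

/-- **Bad injections have large distortion.** With the augmented reduction
construction (with `2 ≤ k ≤ m`, `m ≥ 24`, `ρ ≥ 1`), any injection
`σ : X' → Y'` with `σ(x_{k+1}) ≠ p_{k+1}` satisfies
`dist(σ) = expansion(σ)·expansion(σ⁻¹) ≥ 5ρ/4`. -/
theorem stmt_17 (m k : ℕ) (hm : 24 ≤ m) (hk : 2 ≤ k) (hkm : k ≤ m)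
    (ρ : ℝ) (hρ : 1 ≤ ρ) (G : SimpleGraph (Fin m)) [DecidableRel G.Adj]
    (σ : Fin (k + 1) → Option (Fin k × Fin m))
    (hinj : Function.Injective σ)
    (hlast : σ (Fin.last k) ≠ none) :
    5 * ρ / 4 ≤
      expansionD (dX' k m ρ) (dY' m k G ρ) σ *
      expansionInvD (dX' k m ρ) (dY' m k G ρ) σ := by
  have hm1 : 1 ≤ m := by omega
  have hm0 : (0 : ℝ) < m := by exact_mod_cast hm1
  have hρ0 : 0 < ρ := by linarith
  let x₁ : Fin (k + 1) := ⟨0, by omega⟩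
  let x₂ : Fin (k + 1) := ⟨1, by omega⟩
  have hne : x₁ ≠ x₂ := by simp [x₁, x₂]
  have hx₁ : x₁ ≠ Fin.last k := fun e => by
    have := congrArg Fin.val e
    simp [x₁] at this
    omega
  have hx₂ : x₂ ≠ Fin.last k := fun e => by
    have := congrArg Fin.val e
    simp [x₂] at this
    omega
  have hexp : 1 / (m : ℝ) / (4 * ρ) ≤ expansionD (dX' k m ρ) (dY' m k G ρ) σ := by
    have hd : dX' k m ρ x₁ x₂ = 4 * ρ := by
      rw [dX', if_neg hne, if_neg (by tauto)]
      norm_num [x₁, x₂]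
    refine le_trans ?_ (div_le_expansionD (dX' k m ρ) (dY' m k G ρ) σ hne)
    rw [hd]
    gcongr
    exact one_div_le_dY' hm1 G hρ (hinj.ne hne)
  obtain ⟨x, hx, a, ha⟩ : ∃ x, x ≠ Fin.last k ∧ ∃ a, σ x = some a := by
    rcases h : σ x₁ with _ | a
    · refine ⟨x₂, hx₂, Option.ne_none_iff_exists'.mp fun h₂ => ?_⟩
      exact hne (hinj (h.trans h₂.symm))
    · exact ⟨x₁, hx₁, a, h⟩
  obtain ⟨b, hb⟩ := Option.ne_none_iff_exists'.mp hlast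
  have hinv : 5 * (m : ℝ) * ρ ^ 2 ≤ expansionInvD (dX' k m ρ) (dY' m k G ρ) σ := by
    refine le_trans ?_ (div_le_expansionInvD (dX' k m ρ) (dY' m k G ρ) σ hx)
    have hab : a ≠ b := fun e => hx (hinj (by rw [ha, hb, e]))
    have hpos : 0 < dY m k G a b := (by positivity : 0 < 1 / (m : ℝ)).trans_le
      (one_div_le_dY hm1 G hab)
    rw [ha, hb, dX', if_neg hx, if_pos (Or.inr rfl)]
    change _ ≤ _ / dY m k G a b
    rw [le_div_iff₀ hpos]
    gcongr
    exact dY_le_two_pow m k G a b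
  calc 5 * ρ / 4 = 1 / (m : ℝ) / (4 * ρ) * (5 * (m : ℝ) * ρ ^ 2) := by
        field_simp
    _ ≤ _ := mul_le_mul hexp hinv (by positivity) (le_trans (by positivity) hexp)
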